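/- arXiv:0902.4058 — 4 statements merged into one kernel-verified Lean document; each statement's English description precedes it below -/
import Mathlib

section
/- For every p ∈ (0,3) the class H₊³ in the comparison inequality cannot be replaced by the larger class H₊^p, even for n = 1: there exist strictly positive real numbers σ, y, β with ε := β/(σ²y) ∈ (0,1), a real-valued random variable X with X ≤ y almost surely, E X = 0, E X² = σ² and E X₊³ = β, and a function f ∈ H₊^p, such that E f(X) > E f(Γ_{(1−ε)σ²} + y Π̃_{εσ²/y²}). -/
open MeasureTheory ProbabilityTheory Real

/-- Law of `Γ_{v} + y * (Π_θ - θ)`. -/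
noncomputable def gaussPoissonLaw (v θ y : ℝ) : Measure ℝ :=
  ((gaussianReal 0 v.toNNReal).prod (poissonMeasure θ.toNNReal)).map
    (fun p => p.1 + y * ((p.2 : ℝ) - θ))

/-- The class `H₊^α`. -/
def MemHpos (α : ℝ) (f : ℝ → ℝ) : Prop :=
  ∃ μ : Measure ℝ, ∀ u : ℝ,
    0 ≤ f u ∧
      ENNReal.ofReal (f u) = ∫⁻ t, ENNReal.ofReal (max (u - t) 0 ^ α) ∂μ

lemma exists_pos_lt_rpow_lt {r c δ : ℝ} (hr : 0 < r) (hc : 0 < c) (hδ : 0 < δ) :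
    ∃ x : ℝ, 0 < x ∧ x < δ ∧ x ^ r < c := by
  have h : Filter.Tendsto (fun x : ℝ => x ^ r) (nhdsWithin 0 (Set.Ioi 0)) (nhds 0) := by
    have := (Real.continuousAt_rpow_const 0 r (Or.inr hr.le)).tendsto
    rw [Real.zero_rpow hr.ne'] at this
    exact this.mono_left nhdsWithin_le_nhds
  obtain ⟨x, hx, hx0, hxδ⟩ :=
    ((h.eventually_lt_const hc).and (Ioo_mem_nhdsGT hδ)).exists
  exact ⟨x, hx0, hxδ, hx⟩

/-- A positive part raised to a power `q > p` belongs to `H₊^p`, by the beta integral. -/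
lemma memHpos_max_rpow {p q : ℝ} (hp : 0 < p) (hpq : p < q) :
    MemHpos p (fun u => max u 0 ^ q) := by
  set B := beta (q - p) (p + 1)
  have hBpos : 0 < B := beta_pos (by linarith) (by linarith)
  set d : ℝ → ENNReal := fun t =>
    ENNReal.ofReal (if 0 < t then 1 / B * t ^ (q - p - 1) else 0) with hd
  have hdm : Measurable d := by
    refine ENNReal.measurable_ofReal.comp (Measurable.ite measurableSet_Ioi ?_ measurable_const)
    fun_prop
  refine ⟨volume.withDensity d, fun u => ⟨by positivity, ?_⟩⟩
  rw [lintegral_withDensity_eq_lintegral_mul _ hdm (by fun_prop)]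
  beta_reduce
  rcases le_or_gt u 0 with hu | hu
  · rw [max_eq_right hu, Real.zero_rpow (by linarith), ENNReal.ofReal_zero, eq_comm,
      lintegral_eq_zero_iff (by fun_prop)]
    refine Filter.Eventually.of_forall fun t => ?_
    rcases le_or_gt t 0 with ht | ht
    · simp [hd, ht.not_gt]
    · simp [max_eq_right (show u - t ≤ 0 by linarith), Real.zero_rpow hp.ne']
  · have hscale : ∀ s : ℝ, ENNReal.ofReal |u| *
        (d * fun t => ENNReal.ofReal (max (u - t) 0 ^ p)) (u * s) =
          ENNReal.ofReal (u ^ q) * betaPDF (q - p) (p + 1) s := by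
      intro s
      rcases le_or_gt s 0 with hs | hs
      · rw [betaPDF_eq_zero_of_nonpos hs]
        simp [hd, (mul_nonpos_of_nonneg_of_nonpos hu.le hs).not_gt]
      rcases le_or_gt 1 s with hs1 | hs1
      · rw [betaPDF_eq_zero_of_one_le hs1]
        simp [max_eq_right (show u - u * s ≤ 0 by nlinarith), Real.zero_rpow hp.ne']
      · have h1 : max (u - u * s) 0 = u * (1 - s) := by
          rw [max_eq_left (by nlinarith)]; ring
        rw [betaPDF_of_pos_lt_one hs hs1, Pi.mul_apply, hd]
        simp only [if_pos (mul_pos hu hs), h1]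
        rw [← ENNReal.ofReal_mul (by positivity), ← ENNReal.ofReal_mul (by positivity),
          ← ENNReal.ofReal_mul (by positivity), abs_of_pos hu,
          Real.mul_rpow hu.le hs.le, Real.mul_rpow hu.le (by linarith), add_sub_cancel_right]
        congr 1
        have h2 : u ^ q = u * u ^ (q - p - 1) * u ^ p := by
          nth_rewrite 2 [← Real.rpow_one u]
          rw [← Real.rpow_add hu, ← Real.rpow_add hu]
          ring_nf
        rw [h2]
        ring
    rw [max_eq_left hu.le, ← Real.smul_map_volume_mul_left hu.ne', lintegral_smul_measure,
      lintegral_map (by fun_prop) (by fun_prop), smul_eq_mul,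
      ← lintegral_const_mul _ (by fun_prop), lintegral_congr hscale,
      lintegral_const_mul _ (by unfold betaPDF; fun_prop),
      lintegral_betaPDF_eq_one (by linarith) (by linarith), mul_one]

lemma integrable_abs_rpow_gaussianReal {q : ℝ} (hq : 0 < q) (v : NNReal) :
    Integrable (fun g : ℝ => |g| ^ q) (gaussianReal 0 v) := by
  have h := (memLp_id_gaussianReal' (μ := 0) (v := v) (ENNReal.ofReal q)
    ENNReal.ofReal_ne_top).integrable_norm_rpow (by simpa using hq) ENNReal.ofReal_ne_top
  simpa [ENNReal.toReal_ofReal hq.le] using h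

lemma integral_abs_rpow_gaussianReal (q : ℝ) {v : ℝ} (hv : 0 ≤ v) :
    ∫ g : ℝ, |g| ^ q ∂(gaussianReal 0 v.toNNReal) =
      √v ^ q * ∫ g : ℝ, |g| ^ q ∂(gaussianReal 0 1) := by
  have h : gaussianReal 0 v.toNNReal = (gaussianReal 0 1).map (√v * ·) := by
    rw [gaussianReal_map_const_mul]
    congr 1
    · simp
    · ext
      simp [hv, Real.sq_sqrt]
  rw [h, integral_map (by fun_prop) (Measurable.aestronglyMeasurable (by fun_prop)), ← integral_const_mul]
  refine integral_congr_ae (Filter.Eventually.of_forall fun g => ?_)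
  simp only [abs_mul, abs_of_nonneg (Real.sqrt_nonneg v)]
  exact Real.mul_rpow (Real.sqrt_nonneg v) (abs_nonneg g)

lemma poisson_term_le {q θ : ℝ} (hq0 : 0 < q) (hq3 : q ≤ 3) (h0 : 0 ≤ θ) (h1 : θ ≤ 1) (n : ℕ) :
    rexp (-θ) * θ ^ n / (n.factorial : ℝ) * (n : ℝ) ^ q ≤ θ * (8 ^ n / (n.factorial : ℝ)) := by
  rcases Nat.eq_zero_or_pos n with rfl | hn
  · simp [Real.zero_rpow hq0.ne', h0]
  have hn1 : (1 : ℝ) ≤ n := by exact_mod_cast hn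
  have hnq : (n : ℝ) ^ q ≤ 8 ^ n := by
    calc (n : ℝ) ^ q ≤ (n : ℝ) ^ (3 : ℝ) := Real.rpow_le_rpow_of_exponent_le hn1 hq3
      _ = (n : ℝ) ^ 3 := by norm_cast
      _ ≤ (2 ^ n) ^ 3 := by
        gcongr
        exact_mod_cast (Nat.lt_two_pow_self (n := n)).le
      _ = 8 ^ n := by rw [← pow_mul, mul_comm, pow_mul]; norm_num
  have hθ : rexp (-θ) * θ ^ n ≤ θ := by
    calc rexp (-θ) * θ ^ n ≤ 1 * θ :=
          mul_le_mul (Real.exp_le_one_iff.2 (by linarith)) (pow_le_of_le_one h0 h1 hn.ne')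
            (by positivity) (by norm_num)
      _ = θ := one_mul θ
  calc rexp (-θ) * θ ^ n / (n.factorial : ℝ) * (n : ℝ) ^ q
      ≤ θ / (n.factorial : ℝ) * 8 ^ n := by gcongr
    _ = _ := by ring

lemma integrable_rpow_poissonMeasure {q θ : ℝ} (hq0 : 0 < q) (hq3 : q ≤ 3) (h0 : 0 ≤ θ)
    (h1 : θ ≤ 1) : Integrable (fun n : ℕ => (n : ℝ) ^ q) (poissonMeasure θ.toNNReal) := by
  rw [integrable_poissonMeasure_iff]
  refine Summable.of_nonneg_of_le (fun n => by positivity) (fun n => ?_)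
    ((Real.summable_pow_div_factorial 8).mul_left θ)
  rw [Real.coe_toNNReal _ h0, Real.norm_of_nonneg (by positivity)]
  exact poisson_term_le hq0 hq3 h0 h1 n

lemma integral_rpow_poissonMeasure_le {q θ : ℝ} (hq0 : 0 < q) (hq3 : q ≤ 3) (h0 : 0 ≤ θ)
    (h1 : θ ≤ 1) : ∫ n : ℕ, (n : ℝ) ^ q ∂(poissonMeasure θ.toNNReal) ≤
      θ * ∑' n : ℕ, (8 : ℝ) ^ n / (n.factorial : ℝ) := by
  refine hasSum_le (fun n => ?_)
    (hasSum_integral_poissonMeasure (integrable_rpow_poissonMeasure hq0 hq3 h0 h1))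
    ((Real.summable_pow_div_factorial 8).hasSum.mul_left θ)
  rw [Real.coe_toNNReal _ h0, smul_eq_mul]
  exact poisson_term_le hq0 hq3 h0 h1 n

lemma max_add_rpow_le {q θ : ℝ} (hq0 : 0 < q) (hq3 : q ≤ 3) (h0 : 0 ≤ θ) (g : ℝ) (n : ℕ) :
    max (g + 1 * ((n : ℝ) - θ)) 0 ^ q ≤ 8 * (|g| ^ q + (n : ℝ) ^ q) := by
  have hn : (0 : ℝ) ≤ n := n.cast_nonneg
  have hM : max (g + 1 * ((n : ℝ) - θ)) 0 ≤ 2 * max |g| n := by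
    refine max_le ?_ (by positivity)
    linarith [le_abs_self g, le_max_left |g| (n : ℝ), le_max_right |g| (n : ℝ)]
  have h2 : (2 : ℝ) ^ q ≤ 8 := by
    calc (2 : ℝ) ^ q ≤ 2 ^ (3 : ℝ) := Real.rpow_le_rpow_of_exponent_le (by norm_num) hq3
      _ = 8 := by norm_num
  have hmax : max |g| (n : ℝ) ^ q ≤ |g| ^ q + (n : ℝ) ^ q := by
    rcases max_choice |g| (n : ℝ) with h | h <;> rw [h]
    · linarith [Real.rpow_nonneg hn q]
    · linarith [Real.rpow_nonneg (abs_nonneg g) q]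
  calc max (g + 1 * ((n : ℝ) - θ)) 0 ^ q ≤ (2 * max |g| (n : ℝ)) ^ q :=
        Real.rpow_le_rpow (le_max_right _ _) hM hq0.le
    _ = 2 ^ q * max |g| (n : ℝ) ^ q := Real.mul_rpow (by norm_num) (by positivity)
    _ ≤ 8 * (|g| ^ q + (n : ℝ) ^ q) := by gcongr

lemma integral_max_rpow_gaussPoissonLaw_le {q v θ : ℝ} (hq0 : 0 < q) (hq3 : q ≤ 3)
    (hv : 0 ≤ v) (h0 : 0 ≤ θ) (h1 : θ ≤ 1) :
    ∫ z, max z 0 ^ q ∂(gaussPoissonLaw v θ 1) ≤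
      8 * (√v ^ q * (∫ g : ℝ, |g| ^ q ∂(gaussianReal 0 1)) +
        θ * ∑' n : ℕ, (8 : ℝ) ^ n / (n.factorial : ℝ)) := by
  have hG := (integrable_abs_rpow_gaussianReal hq0 v.toNNReal).comp_fst
    (poissonMeasure θ.toNNReal)
  have hP := (integrable_rpow_poissonMeasure hq0 hq3 h0 h1).comp_snd
    (gaussianReal 0 v.toNNReal)
  rw [gaussPoissonLaw,
    integral_map (by fun_prop) (Measurable.aestronglyMeasurable (by fun_prop))]
  calc ∫ x : ℝ × ℕ, max (x.1 + 1 * ((x.2 : ℝ) - θ)) 0 ^ q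
        ∂((gaussianReal 0 v.toNNReal).prod (poissonMeasure θ.toNNReal))
      ≤ ∫ x : ℝ × ℕ, 8 * (|x.1| ^ q + (x.2 : ℝ) ^ q)
        ∂((gaussianReal 0 v.toNNReal).prod (poissonMeasure θ.toNNReal)) :=
        integral_mono_of_nonneg (Filter.Eventually.of_forall fun x => by positivity)
          ((hG.add hP).const_mul 8)
          (Filter.Eventually.of_forall fun x => max_add_rpow_le hq0 hq3 h0 x.1 x.2)
    _ = 8 * (∫ g : ℝ, |g| ^ q ∂(gaussianReal 0 v.toNNReal) +
          ∫ n : ℕ, (n : ℝ) ^ q ∂(poissonMeasure θ.toNNReal)) := by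
        rw [integral_const_mul, integral_add hG hP,
          integral_fun_fst (fun g : ℝ => |g| ^ q), integral_fun_snd (fun n : ℕ => (n : ℝ) ^ q)]
        simp
    _ ≤ _ := by
        rw [integral_abs_rpow_gaussianReal q hv]
        gcongr
        exact integral_rpow_poissonMeasure_le hq0 hq3 h0 h1

/-- The centred law on the two points `-a` and `b`. -/
noncomputable def twoPointLaw (a b : ℝ) : Measure ℝ :=
  ENNReal.ofReal (a / (a + b)) • Measure.dirac b +
    ENNReal.ofReal (b / (a + b)) • Measure.dirac (-a)

lemma isProbabilityMeasure_twoPointLaw {a b : ℝ} (ha : 0 < a) (hb : 0 < b) :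
    IsProbabilityMeasure (twoPointLaw a b) := by
  constructor
  simp only [twoPointLaw, Measure.add_apply, Measure.smul_apply, measure_univ, smul_eq_mul, mul_one]
  rw [← ENNReal.ofReal_add (by positivity) (by positivity), ← add_div, div_self (by positivity),
    ENNReal.ofReal_one]

lemma integrable_twoPointLaw (a b : ℝ) (f : ℝ → ℝ) : Integrable f (twoPointLaw a b) :=
  ((integrable_dirac (by simp)).smul_measure ENNReal.ofReal_ne_top).add_measure
    ((integrable_dirac (by simp)).smul_measure ENNReal.ofReal_ne_top)

lemma integral_twoPointLaw {a b : ℝ} (ha : 0 < a) (hb : 0 < b) (f : ℝ → ℝ) :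
    ∫ x, f x ∂(twoPointLaw a b) = a / (a + b) * f b + b / (a + b) * f (-a) := by
  rw [twoPointLaw, integral_add_measure
    ((integrable_dirac (by simp)).smul_measure ENNReal.ofReal_ne_top)
    ((integrable_dirac (by simp)).smul_measure ENNReal.ofReal_ne_top),
    integral_smul_measure, integral_smul_measure, integral_dirac, integral_dirac,
    ENNReal.toReal_ofReal (by positivity), ENNReal.toReal_ofReal (by positivity)]
  rfl

/-- For `p ∈ (0,3)` the class `H₊³` cannot be replaced by `H₊^p` in the comparison
inequality, even for a single random variable. -/
theorem H3_optimal (p : ℝ) (hp0 : 0 < p) (hp3 : p < 3) :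
    ∃ (σ y β ε : ℝ), 0 < σ ∧ 0 < y ∧ 0 < β ∧
      ε = β / (σ ^ 2 * y) ∧ 0 < ε ∧ ε < 1 ∧
      ∃ (Ω : Type) (_ : MeasurableSpace Ω) (μ : Measure Ω)
        (_ : IsProbabilityMeasure μ) (X : Ω → ℝ),
        Measurable X ∧ (∀ᵐ ω ∂μ, X ω ≤ y) ∧
        Integrable (fun ω => X ω ^ 2) μ ∧
        (∫ ω, X ω ∂μ) = 0 ∧ (∫ ω, X ω ^ 2 ∂μ) = σ ^ 2 ∧
        (∫ ω, max (X ω) 0 ^ 3 ∂μ) = β ∧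
        ∃ f : ℝ → ℝ, MemHpos p f ∧
          ∫ z, f z ∂(gaussPoissonLaw ((1 - ε) * σ ^ 2) (ε * σ ^ 2 / y ^ 2) y) <
            ∫ ω, f (X ω) ∂μ := by
  obtain ⟨q, hq2, hpq, hq3⟩ : ∃ q : ℝ, 2 < q ∧ p < q ∧ q < 3 := by
    obtain ⟨q, h, hq3⟩ := exists_between (max_lt (by norm_num : (2 : ℝ) < 3) hp3)
    exact ⟨q, (le_max_left _ _).trans_lt h, (le_max_right _ _).trans_lt h, hq3⟩
  set M := ∫ g : ℝ, |g| ^ q ∂(gaussianReal 0 1)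
  set S := ∑' n : ℕ, (8 : ℝ) ^ n / (n.factorial : ℝ)
  have hM0 : 0 ≤ M := integral_nonneg fun g => by positivity
  have hS0 : 0 ≤ S := tsum_nonneg fun n => by positivity
  obtain ⟨b, hb0, hb1, hb⟩ := exists_pos_lt_rpow_lt (r := 3 - q) (c := 1 / (32 * (S + 1)))
    (δ := 1) (by linarith) (by positivity) one_pos
  obtain ⟨s, hs0, hsb, hs⟩ := exists_pos_lt_rpow_lt (r := q / 2 - 1)
    (c := b ^ (q - 2) / (32 * (M + 1))) (δ := b ^ 2) (by linarith) (by positivity) (by positivity)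
  obtain ⟨a, ha0, hab, rfl⟩ : ∃ a : ℝ, 0 < a ∧ a < b ∧ s = a * b := by
    refine ⟨s / b, by positivity, ?_, by field_simp⟩
    rw [div_lt_iff₀ hb0]
    nlinarith
  have hσ : √(a * b) ^ 2 = a * b := Real.sq_sqrt hs0.le
  have hεb : b ^ 2 / (a + b) < b := by
    rw [div_lt_iff₀ (by positivity)]
    nlinarith
  have hε0 : 0 < b ^ 2 / (a + b) := by positivity
  have hnp : max (-a) 0 = 0 := max_eq_right (by linarith)
  have hbp : max b 0 = b := max_eq_left hb0.le
  refine ⟨√(a * b), 1, a / (a + b) * b ^ 3, b ^ 2 / (a + b), by positivity, one_pos,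
    by positivity, ?_, hε0, by linarith, ℝ, inferInstance, twoPointLaw a b,
    isProbabilityMeasure_twoPointLaw ha0 hb0, id, measurable_id, ?_,
    integrable_twoPointLaw a b _, ?_, ?_, ?_, fun u => max u 0 ^ q,
    memHpos_max_rpow hp0 hpq, ?_⟩
  · rw [hσ]
    field_simp
  · simp only [id, twoPointLaw, ae_add_measure_iff]
    constructor
    · refine Measure.ae_smul_measure ?_ _
      rw [ae_dirac_eq]
      exact hb1.le
    · refine Measure.ae_smul_measure ?_ _
      rw [ae_dirac_eq]
      exact (by linarith : -a ≤ 1)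
  · rw [integral_twoPointLaw ha0 hb0]
    simp only [id]
    ring
  · rw [integral_twoPointLaw ha0 hb0, hσ]
    simp only [id]
    field_simp
    ring
  · rw [integral_twoPointLaw ha0 hb0]
    simp only [id, hnp, hbp]
    ring
  · rw [integral_twoPointLaw ha0 hb0, hσ]
    simp only [id, hnp, hbp, Real.zero_rpow (by linarith : q ≠ 0), mul_zero, add_zero]
    set ε := b ^ 2 / (a + b)
    have hθ : ε * (a * b) / 1 ^ 2 ≤ a * b * b := by
      rw [one_pow, div_one]
      nlinarith
    refine (integral_max_rpow_gaussPoissonLaw_le (by linarith) hq3.le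
      (mul_nonneg (by linarith) hs0.le) (by positivity)
      (hθ.trans (by nlinarith))).trans_lt ?_
    have hgauss : √((1 - ε) * (a * b)) ^ q ≤ a * b * (a * b) ^ (q / 2 - 1) := by
      calc √((1 - ε) * (a * b)) ^ q ≤ √(a * b) ^ q := by
            refine Real.rpow_le_rpow (Real.sqrt_nonneg _) (Real.sqrt_le_sqrt ?_) (by linarith)
            nlinarith
        _ = (a * b) ^ (1 + (q / 2 - 1)) := by
            rw [Real.sqrt_eq_rpow, ← Real.rpow_mul hs0.le]
            ring_nf
        _ = _ := by rw [Real.rpow_add hs0, Real.rpow_one]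
    have hb' : b * (32 * (S + 1)) < b ^ (q - 2) := by
      rw [lt_div_iff₀ (by positivity)] at hb
      have : b = b ^ (3 - q) * b ^ (q - 2) := by
        rw [← Real.rpow_add hb0]
        ring_nf
        rw [Real.rpow_one]
      have hpos : 0 < b ^ (q - 2) := by positivity
      nlinarith
    rw [lt_div_iff₀ (by positivity)] at hs
    have hlow : a * b * (b ^ (q - 2) / 2) ≤ a / (a + b) * b ^ q := by
      have hq : b ^ q = b ^ (q - 2) * b ^ 2 := by
        rw [← Real.rpow_natCast b 2, ← Real.rpow_add hb0]
        norm_num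
      have h1 : a / (a + b) * b ^ q - a * b * (b ^ (q - 2) / 2) =
          a * b * b ^ (q - 2) * (b - a) / (2 * (a + b)) := by
        rw [hq]
        field_simp
        ring
      have h2 : 0 ≤ a * b * b ^ (q - 2) * (b - a) / (2 * (a + b)) := by
        have := sub_pos.2 hab
        positivity
      linarith
    have hr0 : 0 < (a * b) ^ (q / 2 - 1) := by positivity
    calc 8 * (√((1 - ε) * (a * b)) ^ q * M + ε * (a * b) / 1 ^ 2 * S)
        ≤ 8 * (a * b * (a * b) ^ (q / 2 - 1) * M + a * b * b * S) := by gcongr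
      _ = a * b * (8 * ((a * b) ^ (q / 2 - 1) * M + b * S)) := by ring
      _ < a * b * (b ^ (q - 2) / 2) := by
          refine mul_lt_mul_of_pos_left ?_ hs0
          nlinarith
      _ ≤ _ := hlow
end

section
/- Let α ∈ (0,∞), let η be a real-valued random variable, and let x ∈ ℝ. Then P_α(η;x) := inf_{t ∈ (−∞,x)} E(η−t)₊^α/(x−t)^α equals both inf{ E f(η) : f ∈ H₊^α and f(u) ≥ 1{u ≥ x} for all u ∈ ℝ } and inf{ E f(η)/f(x) : f ∈ H₊^α, f(x) > 0 }. -/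
open MeasureTheory ProbabilityTheory Real

/-- A measure representing a finite function of class `H₊^α` is σ-finite. -/
lemma sigmaFinite_of_lintegral_posPart_rpow {α : ℝ} (hα : 0 < α) {ν : Measure ℝ}
    (h : ∀ u : ℝ, ∫⁻ t, ENNReal.ofReal (max (u - t) 0 ^ α) ∂ν ≠ ⊤) : SigmaFinite ν := by
  refine ⟨⟨⟨fun n : ℕ => Set.Iic (n : ℝ), fun _ => trivial, fun n => ?_, ?_⟩⟩⟩
  · have hle : ν (Set.Iic (n : ℝ)) ≤
        ∫⁻ t, ENNReal.ofReal (max ((n : ℝ) + 1 - t) 0 ^ α) ∂ν := by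
      rw [← lintegral_indicator_one measurableSet_Iic]
      refine lintegral_mono (Set.indicator_le fun t (ht : t ≤ (n : ℝ)) => ?_)
      rw [Pi.one_apply, ENNReal.one_le_ofReal]
      exact Real.one_le_rpow (le_max_of_le_left (by linarith)) hα.le
    exact hle.trans_lt (h _).lt_top
  · exact Set.eq_univ_of_forall fun t => Set.mem_iUnion.2 (exists_nat_ge t)

/-- The normalized truncated power `u ↦ (u - t)₊^α / (x - t)^α`. -/
noncomputable def normalizedPower (α x t : ℝ) (u : ℝ) : ℝ :=
  max (u - t) 0 ^ α / (x - t) ^ α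

lemma memHpos_normalizedPower (α : ℝ) {x t : ℝ} (ht : t < x) :
    MemHpos α (normalizedPower α x t) := by
  have hpos : 0 < (x - t) ^ α := Real.rpow_pos_of_pos (sub_pos.2 ht) α
  refine ⟨(ENNReal.ofReal ((x - t) ^ α))⁻¹ • Measure.dirac t, fun u => ⟨?_, ?_⟩⟩
  · unfold normalizedPower
    positivity
  · rw [lintegral_smul_measure, lintegral_dirac, normalizedPower,
      ENNReal.ofReal_div_of_pos hpos, div_eq_mul_inv, smul_eq_mul, mul_comm]

lemma normalizedPower_self (α : ℝ) {x t : ℝ} (ht : t < x) : normalizedPower α x t x = 1 := by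
  have hpos : 0 < (x - t) ^ α := Real.rpow_pos_of_pos (sub_pos.2 ht) α
  rw [normalizedPower, max_eq_left (sub_pos.2 ht).le, div_self hpos.ne']

lemma indicator_le_normalizedPower {α : ℝ} (hα : 0 < α) {x t : ℝ} (ht : t < x) (u : ℝ) :
    (if x ≤ u then (1 : ℝ) else 0) ≤ normalizedPower α x t u := by
  have hpos : 0 < (x - t) ^ α := Real.rpow_pos_of_pos (sub_pos.2 ht) α
  unfold normalizedPower
  split_ifs with hu
  · rw [one_le_div hpos]
    exact Real.rpow_le_rpow (sub_pos.2 ht).le (le_max_of_le_left (by linarith)) hα.le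
  · positivity

lemma lintegral_normalizedPower {Ω : Type*} [MeasurableSpace Ω] (μ : Measure Ω) (α : ℝ)
    {η : Ω → ℝ} (hη : Measurable η) {x t : ℝ} (ht : t < x) :
    ∫⁻ ω, ENNReal.ofReal (normalizedPower α x t (η ω)) ∂μ =
      (∫⁻ ω, ENNReal.ofReal (max (η ω - t) 0 ^ α) ∂μ) / ENNReal.ofReal ((x - t) ^ α) := by
  have hpos : 0 < (x - t) ^ α := Real.rpow_pos_of_pos (sub_pos.2 ht) α
  simp only [normalizedPower, ENNReal.ofReal_div_of_pos hpos]
  simp only [div_eq_mul_inv]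
  exact lintegral_mul_const _ (by fun_prop)

/-- A lower bound for all the ratios `E (η - t)₊^α / (x - t)^α` passes to mixtures. -/
lemma mul_le_lintegral_of_memHpos {Ω : Type*} [MeasurableSpace Ω] (μ : Measure Ω) [SFinite μ]
    {α : ℝ} (hα : 0 < α) {η : Ω → ℝ} (hη : Measurable η) {x : ℝ} {c : ENNReal}
    (hc : ∀ t < x, c ≤ (∫⁻ ω, ENNReal.ofReal (max (η ω - t) 0 ^ α) ∂μ) /
      ENNReal.ofReal ((x - t) ^ α)) {f : ℝ → ℝ} (hf : MemHpos α f) :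
    c * ENNReal.ofReal (f x) ≤ ∫⁻ ω, ENNReal.ofReal (f (η ω)) ∂μ := by
  obtain ⟨ν, hν⟩ := hf
  have : SigmaFinite ν := sigmaFinite_of_lintegral_posPart_rpow hα fun u => by
    rw [← (hν u).2]
    exact ENNReal.ofReal_ne_top
  simp only [(hν _).2]
  rw [lintegral_lintegral_swap
      (f := fun ω t => ENNReal.ofReal (max (η ω - t) 0 ^ α))
      (by unfold Function.uncurry; fun_prop),
    ← lintegral_const_mul _ (by fun_prop)]
  refine lintegral_mono fun t => ?_
  rcases lt_or_ge t x with ht | ht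
  · have hpos : 0 < (x - t) ^ α := Real.rpow_pos_of_pos (sub_pos.2 ht) α
    rw [max_eq_left (sub_pos.2 ht).le]
    exact (ENNReal.le_div_iff_mul_le (Or.inl (by simpa using hpos))
      (Or.inl ENNReal.ofReal_ne_top)).1 (hc t ht)
  · simp [Real.zero_rpow hα.ne', max_eq_right (sub_nonpos.2 ht)]

/-- `P_α(η;x) := inf_{t < x} E(η - t)₊^α / (x - t)^α` equals both the infimum of
`E f(η)` over all `f ∈ H₊^α` majorizing `1{· ≥ x}` and the infimum of `E f(η)/f(x)`
over all `f ∈ H₊^α` with `f(x) > 0`. -/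
theorem P_alpha_as_inf_over_H
    {Ω : Type*} [MeasurableSpace Ω] (μ : Measure Ω) [IsProbabilityMeasure μ]
    (α : ℝ) (hα : 0 < α) (η : Ω → ℝ) (hη : Measurable η) (x : ℝ) :
    (⨅ t : Set.Iio x,
        (∫⁻ ω, ENNReal.ofReal (max (η ω - (t : ℝ)) 0 ^ α) ∂μ) /
          ENNReal.ofReal ((x - (t : ℝ)) ^ α)) =
      (⨅ f : {f : ℝ → ℝ // MemHpos α f ∧ ∀ u : ℝ, (if x ≤ u then (1 : ℝ) else 0) ≤ f u},
        ∫⁻ ω, ENNReal.ofReal ((f : ℝ → ℝ) (η ω)) ∂μ) ∧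
    (⨅ t : Set.Iio x,
        (∫⁻ ω, ENNReal.ofReal (max (η ω - (t : ℝ)) 0 ^ α) ∂μ) /
          ENNReal.ofReal ((x - (t : ℝ)) ^ α)) =
      (⨅ f : {f : ℝ → ℝ // MemHpos α f ∧ 0 < f x},
        (∫⁻ ω, ENNReal.ofReal ((f : ℝ → ℝ) (η ω)) ∂μ) / ENNReal.ofReal ((f : ℝ → ℝ) x)) := by
  have key : ∀ f : ℝ → ℝ, MemHpos α f → _ := fun f hf =>
    mul_le_lintegral_of_memHpos μ hα hη
      (fun t ht => iInf_le (fun t : Set.Iio x =>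
        (∫⁻ ω, ENNReal.ofReal (max (η ω - (t : ℝ)) 0 ^ α) ∂μ) /
          ENNReal.ofReal ((x - (t : ℝ)) ^ α)) ⟨t, ht⟩) hf
  refine ⟨le_antisymm (le_iInf ?_) (le_iInf ?_), le_antisymm (le_iInf ?_) (le_iInf ?_)⟩
  · rintro ⟨f, hf, hfx⟩
    have h1 : 1 ≤ ENNReal.ofReal (f x) := by simpa using hfx x
    exact (le_mul_of_one_le_right' h1).trans (key f hf)
  · rintro ⟨t, ht : t < x⟩
    exact iInf_le_of_le ⟨normalizedPower α x t, memHpos_normalizedPower α ht,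
      indicator_le_normalizedPower hα ht⟩ (lintegral_normalizedPower μ α hη ht).le
  · rintro ⟨f, hf, hfx⟩
    exact (ENNReal.le_div_iff_mul_le (Or.inl (by simpa using hfx))
      (Or.inl ENNReal.ofReal_ne_top)).2 (key f hf)
  · rintro ⟨t, ht : t < x⟩
    have h1 := normalizedPower_self α ht
    refine iInf_le_of_le ⟨normalizedPower α x t, memHpos_normalizedPower α ht,
      h1 ▸ one_pos⟩ ?_
    simp only [h1, ENNReal.ofReal_one, div_one]
    exact (lintegral_normalizedPower μ α hη ht).le
end

section
/- Let σ > 0, y > 0, ε ∈ (0,1) and x ≥ 0. Define PU_exp(λ) := exp(λ²(1−ε)σ²/2 + ((e^{λy}−1−λy)/y²)·εσ²) for λ > 0 and PU(x) := inf_{λ>0} e^{−λx} PU_exp(λ). Let w_x be the unique real number w ≥ 0 satisfying w·e^w = (ε/(1−ε))·exp((ε + xy/σ²)/(1−ε)), and set λ_x := (1/y)·((ε + xy/σ²)/(1−ε) − w_x). Then PU(x) = e^{−λ_x x} PU_exp(λ_x) = exp( ((1−ε)²(w_x+1)² − (ε + xy/σ²)² − (1−ε²)) / (2(1−ε)y²/σ²)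 ); moreover λ_x is strictly increasing in x and λ_x → 0 as x → 0 and λ_x → ∞ as x → ∞. -/
open MeasureTheory Real Filter

/-- `PU_exp(λ) = exp(λ²(1-ε)σ²/2 + ((e^{λy}-1-λy)/y²)·εσ²)`. -/
noncomputable def PUexp (σ y ε l : ℝ) : ℝ :=
  Real.exp (l ^ 2 * (1 - ε) * σ ^ 2 / 2 +
    (Real.exp (l * y) - 1 - l * y) / y ^ 2 * (ε * σ ^ 2))

/-- `PU(x) = inf_{λ>0} e^{-λx} PU_exp(λ)`. -/
noncomputable def PU (σ y ε x : ℝ) : ℝ :=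
  ⨅ l : Set.Ioi (0 : ℝ), Real.exp (-(l : ℝ) * x) * PUexp σ y ε (l : ℝ)

/-- If `w e^w = ε/(1-ε) · e^{A/(1-ε)}`, then `u = A/(1-ε) - w` solves
`(1-ε) u + ε e^u = A`, and `ε e^u = (1-ε) w`. -/
lemma lambert_root_critical {ε A w : ℝ} (hε1 : ε < 1)
    (hw : w * Real.exp w = ε / (1 - ε) * Real.exp (A / (1 - ε))) :
    (1 - ε) * (A / (1 - ε) - w) + ε * Real.exp (A / (1 - ε) - w) = A ∧
      ε * Real.exp (A / (1 - ε) - w) = (1 - ε) * w := by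
  have h1 : (1 - ε) ≠ 0 := by linarith
  have hexp : ε * Real.exp (A / (1 - ε) - w) = (1 - ε) * w := by
    rw [Real.exp_sub, ← mul_div_assoc, div_eq_iff (Real.exp_pos w).ne', mul_assoc, hw]
    field_simp
  refine ⟨?_, hexp⟩
  rw [hexp]
  field_simp
  ring

/-- The map `u ↦ (1-ε) u + ε e^u` is strictly increasing. -/
lemma strictMono_linear_add_exp {ε : ℝ} (hε0 : 0 < ε) (hε1 : ε < 1) :
    StrictMono fun u : ℝ => (1 - ε) * u + ε * Real.exp u := by
  intro a b hab
  have h1 : (1 - ε) * a < (1 - ε) * b := mul_lt_mul_of_pos_left hab (by linarith)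
  have h2 : ε * Real.exp a < ε * Real.exp b :=
    mul_lt_mul_of_pos_left (Real.exp_lt_exp.2 hab) hε0
  exact add_lt_add h1 h2

/-- A critical point of the convex function `v ↦ -v A + (1-ε) v²/2 + ε e^v` is a minimizer. -/
lemma convex_exponent_le {ε A u : ℝ} (hε0 : 0 < ε) (hε1 : ε < 1)
    (hu : (1 - ε) * u + ε * Real.exp u = A) (v : ℝ) :
    -u * A + (1 - ε) * u ^ 2 / 2 + ε * Real.exp u ≤
      -v * A + (1 - ε) * v ^ 2 / 2 + ε * Real.exp v := by
  have h1 : Real.exp u * (v - u + 1) ≤ Real.exp v := by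
    have h := mul_le_mul_of_nonneg_left (Real.add_one_le_exp (v - u)) (Real.exp_pos u).le
    rwa [← Real.exp_add, add_sub_cancel] at h
  have h2 := mul_le_mul_of_nonneg_left h1 hε0.le
  have h3 : 0 ≤ (1 - ε) * (v - u) ^ 2 := mul_nonneg (by linarith) (sq_nonneg _)
  subst hu
  linarith

/-- The Chernoff functional written in the rescaled variable `l y`. -/
lemma exp_mul_PUexp {σ y : ℝ} (ε x l : ℝ) (hσ : 0 < σ) (hy : 0 < y) :
    Real.exp (-l * x) * PUexp σ y ε l =
      Real.exp (σ ^ 2 / y ^ 2 * (-(l * y) * (ε + x * y / σ ^ 2) +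
        (1 - ε) * (l * y) ^ 2 / 2 + ε * Real.exp (l * y) - ε)) := by
  rw [PUexp, ← Real.exp_add]
  congr 1
  field_simp
  ring

/-- The infimum defining `PU` is the value at any nonnegative critical point. -/
lemma PU_eq_of_critical {σ y ε x l : ℝ} (hσ : 0 < σ) (hy : 0 < y) (hε0 : 0 < ε) (hε1 : ε < 1)
    (hl : 0 ≤ l)
    (hcrit : (1 - ε) * (l * y) + ε * Real.exp (l * y) = ε + x * y / σ ^ 2) :
    PU σ y ε x = Real.exp (-l * x) * PUexp σ y ε l := by
  have hpos (m : ℝ) : 0 ≤ Real.exp (-m * x) * PUexp σ y ε m := by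
    unfold PUexp
    positivity
  apply le_antisymm
  · have hcont : Continuous fun m : ℝ => Real.exp (-m * x) * PUexp σ y ε m := by
      unfold PUexp
      fun_prop
    have hlim := (hcont.tendsto l).mono_left (nhdsWithin_le_nhds (s := Set.Ioi l))
    refine ge_of_tendsto hlim ?_
    filter_upwards [self_mem_nhdsWithin] with m hm
    exact ciInf_le (f := fun k : Set.Ioi (0 : ℝ) => Real.exp (-(k : ℝ) * x) * PUexp σ y ε k)
      ⟨0, by rintro _ ⟨k, rfl⟩; exact hpos k⟩ ⟨m, hl.trans_lt hm⟩
  · have : Nonempty (Set.Ioi (0 : ℝ)) := ⟨⟨1, Set.mem_Ioi.2 one_pos⟩⟩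
    refine le_ciInf fun m => ?_
    rw [exp_mul_PUexp ε x l hσ hy, exp_mul_PUexp ε x m hσ hy]
    have := convex_exponent_le hε0 hε1 hcrit (m * y)
    gcongr

/-- Computation of the Pinelis–Utev bound `PU(x)` via the Lambert function: `w x` is the
nonnegative root of `w e^w = (ε/(1-ε)) exp((ε + xy/σ²)/(1-ε))` and
`λ_x = (1/y)((ε + xy/σ²)/(1-ε) - w x)`; moreover `λ_x` increases in `x` from `0` to `∞`. -/
theorem PU_lambert (σ y ε : ℝ) (hσ : 0 < σ) (hy : 0 < y) (hε0 : 0 < ε) (hε1 : ε < 1)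
    (w lam : ℝ → ℝ)
    (hw : ∀ x : ℝ, 0 ≤ x → 0 ≤ w x ∧
      w x * Real.exp (w x) = ε / (1 - ε) * Real.exp ((ε + x * y / σ ^ 2) / (1 - ε)))
    (hlam : ∀ x : ℝ, lam x = (1 / y) * ((ε + x * y / σ ^ 2) / (1 - ε) - w x)) :
    (∀ x : ℝ, 0 ≤ x →
      PU σ y ε x = Real.exp (-(lam x) * x) * PUexp σ y ε (lam x) ∧
      PU σ y ε x = Real.exp
        (((1 - ε) ^ 2 * (w x + 1) ^ 2 - (ε + x * y / σ ^ 2) ^ 2 - (1 - ε ^ 2)) /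
          (2 * (1 - ε) * y ^ 2 / σ ^ 2))) ∧
    StrictMonoOn lam (Set.Ici 0) ∧
    Tendsto lam (nhdsWithin 0 (Set.Ici 0)) (nhds 0) ∧
    Tendsto lam atTop atTop := by
  have hε : (1 - ε) ≠ 0 := by linarith
  have hly (x : ℝ) : lam x * y = (ε + x * y / σ ^ 2) / (1 - ε) - w x := by
    rw [hlam]
    field_simp
  have hroot (x : ℝ) (hx : 0 ≤ x) := lambert_root_critical hε1 (hw x hx).2
  simp only [← hly] at hroot
  have hg := strictMono_linear_add_exp hε0 hε1
  have hcoef : 0 < y / σ ^ 2 := by positivity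
  have hlt {m x : ℝ} (hx : 0 ≤ x)
      (h : (1 - ε) * (m * y) + ε * Real.exp (m * y) < ε + x * y / σ ^ 2) : m < lam x := by
    rw [← (hroot x hx).1] at h
    exact lt_of_mul_lt_mul_right (hg.lt_iff_lt.1 h) hy.le
  have hnonneg (x : ℝ) (hx : 0 ≤ x) : 0 ≤ lam x := by
    have ht : 0 ≤ x * y / σ ^ 2 := by positivity
    have h0 : (1 - ε) * 0 + ε * Real.exp 0 ≤
        (1 - ε) * (lam x * y) + ε * Real.exp (lam x * y) := by
      rw [(hroot x hx).1, Real.exp_zero]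
      linarith
    exact nonneg_of_mul_nonneg_left (hg.le_iff_le.1 h0) hy
  refine ⟨fun x hx => ?_, fun a ha b hb hab => ?_, ?_, ?_⟩
  · have h := PU_eq_of_critical hσ hy hε0 hε1 (hnonneg x hx) (hroot x hx).1
    refine ⟨h, ?_⟩
    rw [h, exp_mul_PUexp ε x _ hσ hy, (hroot x hx).2, hly]
    congr 1
    generalize ε + x * y / σ ^ 2 = A
    field_simp
    ring
  · apply hlt hb
    rw [(hroot a ha).1]
    gcongr
  · have hbound (x : ℝ) (hx : 0 ≤ x) : lam x ≤ x / σ ^ 2 := by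
      have h1 := mul_le_mul_of_nonneg_left (Real.add_one_le_exp (lam x * y)) hε0.le
      have h2 : lam x * y ≤ x / σ ^ 2 * y := by
        rw [div_mul_eq_mul_div]
        linarith [(hroot x hx).1]
      exact le_of_mul_le_mul_right h2 hy
    have hlim : Tendsto (fun x : ℝ => x / σ ^ 2) (nhdsWithin 0 (Set.Ici 0)) (nhds 0) := by
      have hc : Continuous fun x : ℝ => x / σ ^ 2 := by fun_prop
      simpa using (hc.tendsto 0).mono_left (nhdsWithin_le_nhds (s := Set.Ici 0))
    refine tendsto_of_tendsto_of_tendsto_of_le_of_le' tendsto_const_nhds hlim ?_ ?_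
    · filter_upwards [self_mem_nhdsWithin] with x hx using hnonneg x hx
    · filter_upwards [self_mem_nhdsWithin] with x hx using hbound x hx
  · have hlim : Tendsto (fun x : ℝ => ε + x * y / σ ^ 2) atTop atTop := by
      simp only [mul_div_assoc]
      exact tendsto_atTop_add_const_left _ _ (tendsto_id.atTop_mul_const hcoef)
    refine tendsto_atTop.2 fun m => ?_
    filter_upwards [eventually_ge_atTop 0, hlim.eventually_gt_atTop _] with x hx hm
    exact (hlt hx hm).le
end

section
/- Let y > 0 and σ > 0, and let X be a real-valued random variable such that X ≤ y almost surely, E X ≤ 0, and E X² ≤ σ². Then E X₊³ ≤ y³σ²/(y² + σ²). -/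
open MeasureTheory

/-- On `(-∞, y]`, the function `x₊³` is dominated by the quadratic that vanishes to second order at
`-s / y` and agrees with it at `y`. -/
lemma max_zero_pow_three_le_quadratic {x y s : ℝ} (hy : 0 < y) (hs : 0 < s) (hxy : x ≤ y) :
    max x 0 ^ 3 ≤ y ^ 3 / (y ^ 2 + s) ^ 2 * (y ^ 2 * x ^ 2 + 2 * y * s * x + s ^ 2) := by
  have hquad : y ^ 2 * x ^ 2 + 2 * y * s * x + s ^ 2 = (x * y + s) ^ 2 := by ring
  rw [hquad]
  rcases le_total x 0 with hx | hx
  · rw [max_eq_right hx, zero_pow three_ne_zero]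
    positivity
  · rw [max_eq_left hx, div_mul_eq_mul_div, le_div_iff₀ (by positivity)]
    have hlin : x * (y ^ 2 + s) ≤ y * (x * y + s) := by nlinarith
    calc x ^ 3 * (y ^ 2 + s) ^ 2 = x * (x * (y ^ 2 + s)) ^ 2 := by ring
      _ ≤ y * (y * (x * y + s)) ^ 2 := by gcongr
      _ = y ^ 3 * (x * y + s) ^ 2 := by ring

/-- If `X ≤ y` a.s., `E X ≤ 0` and `E X² ≤ σ²`, then `E X₊³ ≤ y³σ²/(y² + σ²)`. -/
theorem truncated_third_moment_bound
    {Ω : Type*} [MeasurableSpace Ω] (μ : Measure Ω) [IsProbabilityMeasure μ]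
    (y σ : ℝ) (hy : 0 < y) (hσ : 0 < σ)
    (X : Ω → ℝ) (hX : Measurable X)
    (hsq : Integrable (fun ω => X ω ^ 2) μ)
    (hbdd : ∀ᵐ ω ∂μ, X ω ≤ y)
    (hmean : ∫ ω, X ω ∂μ ≤ 0)
    (hvar : ∫ ω, X ω ^ 2 ∂μ ≤ σ ^ 2) :
    ∫ ω, max (X ω) 0 ^ 3 ∂μ ≤ y ^ 3 * σ ^ 2 / (y ^ 2 + σ ^ 2) := by
  have hs : 0 < σ ^ 2 := by positivity
  have hint : Integrable X μ :=
    ((memLp_two_iff_integrable_sq hX.aestronglyMeasurable).2 hsq).integrable one_le_two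
  have hsq' : Integrable (fun ω => y ^ 2 * X ω ^ 2) μ := hsq.const_mul _
  have hint' : Integrable (fun ω => 2 * y * σ ^ 2 * X ω) μ := hint.const_mul _
  have hquad : Integrable (fun ω => y ^ 2 * X ω ^ 2 + 2 * y * σ ^ 2 * X ω) μ := hsq'.add hint'
  calc ∫ ω, max (X ω) 0 ^ 3 ∂μ
      ≤ ∫ ω, y ^ 3 / (y ^ 2 + σ ^ 2) ^ 2 *
          (y ^ 2 * X ω ^ 2 + 2 * y * σ ^ 2 * X ω + (σ ^ 2) ^ 2) ∂μ := by
        refine integral_mono_of_nonneg (.of_forall fun ω => by positivity)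
          ((hquad.add (integrable_const _)).const_mul _) ?_
        filter_upwards [hbdd] with ω hω using max_zero_pow_three_le_quadratic hy hs hω
    _ = y ^ 3 / (y ^ 2 + σ ^ 2) ^ 2 *
          (y ^ 2 * ∫ ω, X ω ^ 2 ∂μ + 2 * y * σ ^ 2 * ∫ ω, X ω ∂μ + (σ ^ 2) ^ 2) := by
        rw [integral_const_mul, integral_add hquad (integrable_const _), integral_add hsq' hint',
          integral_const_mul, integral_const_mul, integral_const, probReal_univ, one_smul]
    _ ≤ y ^ 3 / (y ^ 2 + σ ^ 2) ^ 2 *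
          (y ^ 2 * σ ^ 2 + 2 * y * σ ^ 2 * 0 + (σ ^ 2) ^ 2) := by gcongr
    _ = y ^ 3 * σ ^ 2 / (y ^ 2 + σ ^ 2) := by
        field_simp
        ring
end
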